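/- arXiv:1610.06012 — 6 statements merged into one kernel-verified Lean document; each statement's English description precedes it below -/
import Mathlib

section
/- Let m ≥ 1, let V' ∈ ℝ^{c+m} and V ∈ ℝ^c be workload vectors with V' ⊴ V, and let S ≥ 0. Then after a single arrival with service duration S in each system, the ordering is preserved: arr_S(V') ⊴ arr_S(V). -/
open scoped Classical

noncomputable section

/-- The `k`-th coordinate (0-based) of a vector in `ℝ^n`, defaulting to 0 out of range. -/
def coord {n : ℕ} (V : Fin n → ℝ) (k : ℕ) : ℝ :=
  if h : k < n then V ⟨k, h⟩ else 0

/-- A workload vector: coordinates nonnegative and in increasing order. -/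
def IsWorkload {n : ℕ} (V : Fin n → ℝ) : Prop :=
  Monotone V ∧ ∀ i, 0 ≤ V i

/-- Add the service duration `S` to the minimal (first) coordinate. -/
def bump {n : ℕ} (S : ℝ) (V : Fin n → ℝ) : Fin n → ℝ :=
  fun i => if (i : ℕ) = 0 then V i + S else V i

/-- The arrival step: increasing rearrangement of the vector obtained from `V`
by replacing its minimal coordinate `V(1)` by `V(1) + S`. -/
def arr {n : ℕ} (S : ℝ) (V : Fin n → ℝ) : Fin n → ℝ :=
  bump S V ∘ Tuple.sort (bump S V)

/-- The decay step: each coordinate decreases by `t`, truncated at 0. -/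
def dec {n : ℕ} (t : ℝ) (V : Fin n → ℝ) : Fin n → ℝ :=
  fun i => max (V i - t) 0

/-- The Kiefer-Wolfowitz one-step update with service `S` and elapsed time `t`. -/
def step {n : ℕ} (S t : ℝ) (V : Fin n → ℝ) : Fin n → ℝ :=
  dec t (arr S V)

/-- `kU S V` (1-based): the least `k ∈ {1,…,n−1}` with `V(1)+S ≤ V(k+1)`
(0-based: `coord V 0 + S ≤ coord V k`), and `n` if there is no such `k`. -/
def kU {n : ℕ} (S : ℝ) (V : Fin n → ℝ) : ℕ :=
  sInf ({k : ℕ | 1 ≤ k ∧ k < n ∧ coord V 0 + S ≤ coord V k} ∪ {n})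

/-- `OrdDom V W` (i.e. `V ⊴ W`): each of the `c` busiest servers of `V ∈ ℝ^{c+m}`
has no more work than the corresponding server of `W ∈ ℝ^c`. -/
def OrdDom {c m : ℕ} (V : Fin (c + m) → ℝ) (W : Fin c → ℝ) : Prop :=
  ∀ k : ℕ, k < c → coord V (k + m) ≤ coord W k

/-- The time-to-coalescence `C(L,U)`: equal to `U(n)` for
`n = max{k : L(k) ≠ U(k)}` when `L ≠ U`, and `0` when `L = U`. -/
def coalTime {n : ℕ} (L U : Fin n → ℝ) : ℝ :=
  if L = U then 0 else coord U (sSup {k : ℕ | k < n ∧ coord L k ≠ coord U k})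

end

/-- The `k`-th smallest coordinate after an arrival is at most `x` exactly when more than `k`
coordinates of the unsorted vector are at most `x`. -/
theorem arr_apply_le_iff {n : ℕ} (S : ℝ) (V : Fin n → ℝ) (k : Fin n) (x : ℝ) :
    arr S V k ≤ x ↔ (k : ℕ) < (Finset.univ.filter fun i => bump S V i ≤ x).card := by
  have hcard : (Finset.univ.filter fun i => arr S V i ≤ x).card =
      (Finset.univ.filter fun i => bump S V i ≤ x).card :=
    Finset.card_equiv (Tuple.sort (bump S V)) fun i => by
      simp only [Finset.mem_filter, Finset.mem_univ, true_and]
      rfl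
  rw [← hcard]
  exact (Tuple.lt_card_le_iff_apply_le_of_monotone (Tuple.monotone_sort (bump S V))).symm

/-- If the image of `s` under a shift by `m` lies in `t`, and so do `m` consecutive indices
starting at `e`, all lying below that image, then `t` has at least `m` more elements than `s`. -/
theorem card_add_le_card_of_shift {c m : ℕ} (s : Finset (Fin c)) (t : Finset (Fin (c + m)))
    (e : ℕ) (he : ∀ j ∈ s, e ≤ (j : ℕ)) (hem : e + m ≤ c + m)
    (hshift : ∀ j ∈ s, j.addNat m ∈ t)
    (hlow : ∀ i : Fin m, (⟨i + e, by omega⟩ : Fin (c + m)) ∈ t) :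
    s.card + m ≤ t.card := by
  let f : Fin c ⊕ Fin m → Fin (c + m) :=
    Sum.elim (fun j => j.addNat m) (fun i => ⟨i + e, by omega⟩)
  have hcard : (s.disjSum (Finset.univ : Finset (Fin m))).card = s.card + m := by simp
  rw [← hcard]
  refine Finset.card_le_card_of_injOn f ?_ ?_
  · rintro (j | i) h
    · exact hshift j (by simpa using h)
    · exact hlow i
  · rintro (j | i) h (j' | i') h' heq
    · simp only [f, Sum.elim_inl, Fin.ext_iff, Fin.val_addNat] at heq
      exact congrArg _ (Fin.ext (by omega))
    · have := he j (by simpa using h)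
      simp only [f, Sum.elim_inl, Sum.elim_inr, Fin.ext_iff, Fin.val_addNat] at heq
      omega
    · have := he j' (by simpa using h')
      simp only [f, Sum.elim_inl, Sum.elim_inr, Fin.ext_iff, Fin.val_addNat] at heq
      omega
    · simp only [f, Sum.elim_inr, Fin.ext_iff] at heq
      exact congrArg _ (Fin.ext (by omega))

/-- A single arrival with the same service duration in each system
preserves the ordering `V' ⊴ V` between workload vectors with `c+m` and `c` servers. -/
theorem stmt2 {c m : ℕ} (hc : 1 ≤ c) (hm : 1 ≤ m)
    (V' : Fin (c + m) → ℝ) (V : Fin c → ℝ)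
    (hV' : IsWorkload V') (hV : IsWorkload V)
    (hdom : OrdDom V' V) (S : ℝ) (hS : 0 ≤ S) :
    OrdDom (arr S V') (arr S V) := by
  have hdom' (j : Fin c) : V' (j.addNat m) ≤ V j := by
    simpa [coord, Fin.addNat] using hdom j j.isLt
  have hle {i : Fin (c + m)} (hi : (i : ℕ) ≤ m) : V' i ≤ V ⟨0, hc⟩ :=
    (hV'.1 (Fin.le_def.2 (by simpa using hi))).trans (hdom' ⟨0, hc⟩)
  intro k hk
  have hkm : k + m < c + m := by omega
  simp only [coord, hk, hkm, dif_pos]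
  set x := arr S V ⟨k, hk⟩
  have hcount := (arr_apply_le_iff S V ⟨k, hk⟩ x).1 le_rfl
  rw [arr_apply_le_iff]
  refine lt_of_lt_of_le (Nat.add_lt_add_right hcount m) ?_
  have hVj {j : Fin c} (hj : bump S V j ≤ x) : V j ≤ x := by
    unfold bump at hj
    split_ifs at hj <;> linarith
  have hshift : ∀ j ∈ Finset.univ.filter (fun i => bump S V i ≤ x),
      j.addNat m ∈ Finset.univ.filter (fun i => bump S V' i ≤ x) := by
    intro j hj
    have hj' := hVj (Finset.mem_filter.1 hj).2
    have hne : ((j.addNat m : Fin (c + m)) : ℕ) ≠ 0 := by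
      rw [Fin.val_addNat]; omega
    refine Finset.mem_filter.2 ⟨Finset.mem_univ _, ?_⟩
    simpa only [bump, if_neg hne] using (hdom' j).trans hj'
  by_cases h0 : V ⟨0, hc⟩ + S ≤ x
  · refine card_add_le_card_of_shift _ _ 0 (fun _ _ => Nat.zero_le _) (by omega) hshift ?_
    intro i
    have := hle (i := ⟨i + 0, by omega⟩) (by simp only; omega)
    refine Finset.mem_filter.2 ⟨Finset.mem_univ _, ?_⟩
    unfold bump
    split_ifs <;> linarith
  · refine card_add_le_card_of_shift _ _ 1 ?_ (by omega) hshift ?_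
    · intro j hj
      by_contra hlt
      obtain rfl : j = ⟨0, hc⟩ := Fin.ext (by simp only; omega)
      exact h0 (by simpa [bump] using (Finset.mem_filter.1 hj).2)
    · intro i
      obtain ⟨j, hj⟩ := Finset.card_pos.1 (Nat.zero_lt_of_lt hcount)
      have hj' := hVj (Finset.mem_filter.1 hj).2
      have h0j : V ⟨0, hc⟩ ≤ V j := hV.1 (Fin.le_def.2 (Nat.zero_le _))
      have := hle (i := ⟨i + 1, by omega⟩) (by simp only; omega)
      refine Finset.mem_filter.2 ⟨Finset.mem_univ _, ?_⟩
      rw [bump, if_neg (Nat.succ_ne_zero _)]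
      linarith
end

section
/- Let m ≥ 1, let V' ∈ ℝ^{c+m} and V ∈ ℝ^c be workload vectors with V' ⊴ V, let S ≥ 0 and t ≥ 0. Then the full Kiefer–Wolfowitz one-step update preserves the ordering: step_{S,t}(V') ⊴ step_{S,t}(V). -/
open scoped Classical

/-- An entry of the increasing rearrangement is at most `a` iff enough entries of the
bumped vector are. -/
theorem arr_le_iff {n : ℕ} (S : ℝ) (V : Fin n → ℝ) (i : Fin n) (a : ℝ) :
    arr S V i ≤ a ↔ (i : ℕ) < (Finset.univ.filter fun j => bump S V j ≤ a).card := by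
  have h := Tuple.lt_card_le_iff_apply_le_of_monotone (f := arr S V) (a := a) (j := i)
    (Tuple.monotone_sort (bump S V))
  rw [← h, ← Fintype.card_subtype, ← Fintype.card_subtype,
    Fintype.card_congr ((Tuple.sort (bump S V)).subtypeEquiv
      (p := fun j => arr S V j ≤ a) (q := fun j => bump S V j ≤ a) fun _ => Iff.rfl)]

theorem OrdDom.apply_addNat_le {c m : ℕ} {V' : Fin (c + m) → ℝ} {V : Fin c → ℝ}
    (h : OrdDom V' V) (i : Fin c) : V' (i.addNat m) ≤ V i := by
  have hi := h i i.isLt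
  have h1 : (i : ℕ) + m < c + m := by omega
  simp only [coord, h1, i.isLt, dif_pos] at hi
  exact hi

theorem card_bump_le_add {c m : ℕ} (hm : 1 ≤ m) {V' : Fin (c + m) → ℝ} {V : Fin c → ℝ}
    (hV' : Monotone V') (hV : Monotone V) (hdom : OrdDom V' V) {S : ℝ} (hS : 0 ≤ S) {a : ℝ}
    (hne : 0 < (Finset.univ.filter fun j => bump S V j ≤ a).card) :
    (Finset.univ.filter fun j => bump S V j ≤ a).card + m ≤
      (Finset.univ.filter fun j => bump S V' j ≤ a).card := by
  obtain ⟨i₀, hi₀⟩ := Finset.card_pos.mp hne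
  have hi₀ : bump S V i₀ ≤ a := (Finset.mem_filter.mp hi₀).2
  have hc : 0 < c := i₀.pos
  have le_bump (i : Fin c) : V i ≤ bump S V i := by
    unfold bump; split_ifs <;> linarith
  have hV0 : V ⟨0, hc⟩ ≤ a := (hV (Fin.mk_le_of_le_val (Nat.zero_le _))).trans
    ((le_bump i₀).trans hi₀)
  have hlow (j : Fin (c + m)) (hj : (j : ℕ) ≤ m) : V' j ≤ V ⟨0, hc⟩ := by
    refine le_trans (hV' ?_) (hdom.apply_addNat_le ⟨0, hc⟩)
    simpa [Fin.le_def] using hj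
  have hhigh (i : Fin c) (hi : bump S V i ≤ a) : bump S V' (i.addNat m) ≤ a := by
    have h0 : ((i.addNat m : Fin (c + m)) : ℕ) ≠ 0 := by simp; omega
    rw [bump, if_neg h0]
    exact (hdom.apply_addNat_le i).trans ((le_bump i).trans hi)
  -- The `m` extra small entries start at `0` if the bumped minimum is small, and at `1` otherwise.
  obtain ⟨d, hd, hdlow, hdhigh⟩ : ∃ d : ℕ, d ≤ 1 ∧
      (∀ j : Fin (c + m), d ≤ j → (j : ℕ) ≤ m → bump S V' j ≤ a) ∧
      ∀ i : Fin c, bump S V i ≤ a → d ≤ i := by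
    by_cases h : bump S V ⟨0, hc⟩ ≤ a
    · refine ⟨0, by omega, fun j _ hj => ?_, fun _ _ => Nat.zero_le _⟩
      simp only [bump, if_true] at h
      have := hlow j hj
      unfold bump; split_ifs <;> linarith
    · refine ⟨1, le_rfl, fun j hj hjm => ?_, fun i hi => ?_⟩
      · rw [bump, if_neg (by omega)]
        exact (hlow j hjm).trans hV0
      · by_contra hlt
        obtain rfl : i = ⟨0, hc⟩ := Fin.ext (by simp; omega)
        exact h hi
  let low : Fin m → Fin (c + m) := fun p => ⟨p + d, by omega⟩
  let A := Finset.univ.filter fun j => bump S V j ≤ a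
  have hcard : (A.disjSum (Finset.univ : Finset (Fin m))).card = A.card + m := by simp
  rw [← hcard]
  refine Finset.card_le_card_of_injOn (Sum.elim (fun i => i.addNat m) low) ?_ ?_
  · rintro (i | p) hx
    · have hi : bump S V i ≤ a := by simpa [A] using hx
      simpa using hhigh i hi
    · simpa using hdlow (low p) (by simp [low]) (by simp [low]; omega)
  · rintro (i | p) hx (i' | p') hx' h
    · simpa [Fin.ext_iff] using h
    · have hi : bump S V i ≤ a := by simpa [A] using hx
      have := hdhigh i hi
      simp [low, Fin.ext_iff] at h
      omega
    · have hi : bump S V i' ≤ a := by simpa [A] using hx'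
      have := hdhigh i' hi
      simp [low, Fin.ext_iff] at h
      omega
    · simpa [low, Fin.ext_iff] using h

/-- The full Kiefer-Wolfowitz one-step update preserves the ordering
`V' ⊴ V` between workload vectors with `c+m` and `c` servers. -/
theorem stmt3 {c m : ℕ} (hc : 1 ≤ c) (hm : 1 ≤ m)
    (V' : Fin (c + m) → ℝ) (V : Fin c → ℝ)
    (hV' : IsWorkload V') (hV : IsWorkload V)
    (hdom : OrdDom V' V) (S t : ℝ) (hS : 0 ≤ S) (ht : 0 ≤ t) :
    OrdDom (step S t V') (step S t V) := by
  intro k hk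
  have hk' : k + m < c + m := by omega
  simp only [coord, hk, hk', dif_pos, step, dec]
  refine max_le_max_right 0 (sub_le_sub_right ?_ t)
  have hlt := (arr_le_iff S V ⟨k, hk⟩ _).mp le_rfl
  have hcard := card_bump_le_add hm hV'.1 hV.1 hdom hS (Nat.zero_lt_of_lt hlt)
  exact (arr_le_iff S V' ⟨k + m, hk'⟩ _).mpr
    (lt_of_lt_of_le (Nat.add_lt_add_right hlt m) hcard)
end

section
/- Let L, U ∈ ℝ^c be workload vectors with L(k) ≤ U(k) for all k, and let t ≥ 0. Then the time-to-coalescence decreases deterministically at unit rate under decay: C(dec_t(L), dec_t(U)) = max{C(L,U) − t, 0}. -/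
open scoped Classical

/-- `coalTime L U` is the coordinate of `U` at the last index where `L` and `U` differ. -/
theorem coalTime_eq_of_last_ne {n : ℕ} {L U : Fin n → ℝ} {i : Fin n} (hi : L i ≠ U i)
    (h : ∀ j, i < j → L j = U j) : coalTime L U = U i := by
  have hg : IsGreatest {k : ℕ | k < n ∧ coord L k ≠ coord U k} i := by
    refine ⟨⟨i.2, by simpa [coord] using hi⟩, ?_⟩
    rintro k ⟨hk, hne⟩
    by_contra! hlt
    exact hne (by simpa [coord, hk] using h ⟨k, hk⟩ hlt)
  have hne : L ≠ U := fun e => hi (congrFun e i)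
  rw [coalTime, if_neg hne, hg.csSup_eq]
  simp [coord]

/-- Two distinct vectors have a last index where they differ. -/
theorem exists_last_ne {n : ℕ} {L U : Fin n → ℝ} (h : L ≠ U) :
    ∃ i, L i ≠ U i ∧ ∀ j, i < j → L j = U j := by
  obtain ⟨k, hk⟩ := Function.ne_iff.mp h
  obtain ⟨i, -, hi⟩ := (Set.toFinite {i | L i ≠ U i}).exists_le_maximal (a := k) hk
  exact ⟨i, hi.prop, fun j hj => by_contra fun hne => hi.not_prop_of_gt hj hne⟩

/-- the time-to-coalescence decreases deterministically at unit rate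
under decay: `C(dec t L, dec t U) = max (C(L,U) - t) 0`. -/
theorem stmt5 {c : ℕ} (hc : 1 ≤ c) (L U : Fin c → ℝ)
    (hL : IsWorkload L) (hU : IsWorkload U) (hLU : ∀ k, L k ≤ U k)
    (t : ℝ) (ht : 0 ≤ t) :
    coalTime (dec t L) (dec t U) = max (coalTime L U - t) 0 := by
  by_cases heq : L = U
  · simp [heq, coalTime, ht]
  obtain ⟨i, hi, hlast⟩ := exists_last_ne heq
  rw [coalTime_eq_of_last_ne hi hlast]
  rcases le_or_gt (U i) t with hle | hlt
  · have hdec : dec t L = dec t U := by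
      funext j
      rcases lt_or_ge i j with hj | hj
      · simp [dec, hlast j hj]
      · have hUj : U j ≤ t := (hU.1 hj).trans hle
        have hLj : L j ≤ t := (hLU j).trans hUj
        simp [dec, hUj, hLj]
    simp [coalTime, hdec, hle]
  · have hne : dec t L i ≠ dec t U i := by
      have hlt' : L i < U i := lt_of_le_of_ne (hLU i) hi
      refine (lt_of_lt_of_le (max_lt ?_ ?_) (le_max_left _ _)).ne <;> linarith
    rw [coalTime_eq_of_last_ne hne fun j hj => by simp [dec, hlast j hj], dec]
end

section
/- (Equation for the change in C, case 1.) Let L, U ∈ ℝ^c be workload vectors with L(k) ≤ U(k) for all k, and suppose the minimal coordinates agree: L(1) = U(1). Then for any service duration S > 0 the time-to-coalescence is unchanged by an arrival: C(arr_S(L), arr_S(U)) = C(L, U). -/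
open scoped Classical

/-- The number of coordinates of `V` that are at least `t`. -/
noncomputable def countGe {n : ℕ} (V : Fin n → ℝ) (t : ℝ) : ℕ :=
  (Finset.univ.filter fun i => t ≤ V i).card

theorem countGe_eq_sum {n : ℕ} (V : Fin n → ℝ) (t : ℝ) :
    countGe V t = ∑ i, if t ≤ V i then 1 else 0 :=
  Finset.card_filter _ _

theorem coord_fin {n : ℕ} (V : Fin n → ℝ) (i : Fin n) : coord V i = V i := by
  simp [coord]

theorem le_iff_le_countGe {n : ℕ} {V : Fin n → ℝ} (hV : Monotone V) (i : Fin n) (t : ℝ) :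
    t ≤ V i ↔ n - (i : ℕ) ≤ countGe V t := by
  constructor
  · intro h
    rw [← Fin.card_Ici i]
    refine Finset.card_le_card fun j hj => ?_
    simpa using h.trans (hV (Finset.mem_Ici.1 hj))
  · intro h
    by_contra hlt
    have hle : countGe V t ≤ (Finset.Ioi i).card := by
      refine Finset.card_le_card fun j hj => ?_
      rw [Finset.mem_Ioi]
      by_contra hji
      exact hlt ((Finset.mem_filter.1 hj).2.trans (hV (not_lt.1 hji)))
    rw [Fin.card_Ioi] at hle
    have := i.isLt
    omega

theorem countGe_mono {n : ℕ} {L U : Fin n → ℝ} (h : ∀ i, L i ≤ U i) (t : ℝ) :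
    countGe L t ≤ countGe U t :=
  Finset.card_le_card fun i hi => by
    simpa using (Finset.mem_filter.1 hi).2.trans (h i)

theorem le_of_countGe_le {n : ℕ} {L U : Fin n → ℝ} (hL : Monotone L) (hU : Monotone U)
    (h : ∀ t, countGe L t ≤ countGe U t) (i : Fin n) : L i ≤ U i :=
  (le_iff_le_countGe hU i _).2 (((le_iff_le_countGe hL i _).1 le_rfl).trans (h _))

theorem countGe_comp_perm {n : ℕ} (V : Fin n → ℝ) (σ : Equiv.Perm (Fin n)) (t : ℝ) :
    countGe (V ∘ σ) t = countGe V t := by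
  simp only [countGe_eq_sum, Function.comp_apply]
  exact Equiv.sum_comp σ fun i => if t ≤ V i then 1 else 0

theorem countGe_bump {n : ℕ} (hn : 1 ≤ n) (S : ℝ) (V : Fin n → ℝ) (t : ℝ) :
    countGe (bump S V) t + (if t ≤ coord V 0 then 1 else 0) =
      countGe V t + (if t ≤ coord V 0 + S then 1 else 0) := by
  obtain ⟨m, rfl⟩ : ∃ m, n = m + 1 := ⟨n - 1, by omega⟩
  have h0 : coord V 0 = V 0 := coord_fin V 0
  have hzero : bump S V 0 = V 0 + S := by simp [bump]
  have hsucc : ∀ i : Fin m, bump S V i.succ = V i.succ := fun i => by simp [bump]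
  simp only [countGe_eq_sum, Fin.sum_univ_succ, h0, hzero, hsucc]
  omega

theorem arr_monotone {n : ℕ} (S : ℝ) (V : Fin n → ℝ) : Monotone (arr S V) :=
  Tuple.monotone_sort _

theorem countGe_arr {n : ℕ} (hn : 1 ≤ n) (S : ℝ) (V : Fin n → ℝ) (t : ℝ) :
    countGe (arr S V) t + (if t ≤ coord V 0 then 1 else 0) =
      countGe V t + (if t ≤ coord V 0 + S then 1 else 0) := by
  rw [arr, countGe_comp_perm, countGe_bump hn]

/-- The time-to-coalescence is the largest level at which the two counting functions differ. -/
theorem coalTime_eq_sSup {n : ℕ} {L U : Fin n → ℝ} (hL : Monotone L) (hU : Monotone U)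
    (hLU : ∀ i, L i ≤ U i) :
    coalTime L U = sSup {t | countGe L t ≠ countGe U t} := by
  by_cases h : L = U
  · simp [coalTime, h]
  obtain ⟨j, hj⟩ := Function.ne_iff.1 h
  obtain ⟨m, hm, hmax⟩ := (Finset.univ.filter fun i => L i ≠ U i).exists_max_image id
    ⟨j, by simpa using hj⟩
  replace hm : L m ≠ U m := by simpa using hm
  replace hmax : ∀ i, L i ≠ U i → i ≤ m := fun i hi => hmax i (by simpa using hi)
  have hidx : IsGreatest {k : ℕ | k < n ∧ coord L k ≠ coord U k} m := by
    refine ⟨⟨m.isLt, by simpa only [coord_fin] using hm⟩, ?_⟩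
    rintro k ⟨hk, hne⟩
    exact hmax ⟨k, hk⟩ (by simpa [coord, hk] using hne)
  have hlevel : IsGreatest {t | countGe L t ≠ countGe U t} (U m) := by
    refine ⟨fun heq => ?_, fun t ht => ?_⟩
    · have hcount := (le_iff_le_countGe hU m _).1 le_rfl
      rw [← heq, ← le_iff_le_countGe hL] at hcount
      exact hm (le_antisymm (hLU m) hcount)
    · by_contra hlt
      refine ht (congrArg Finset.card (Finset.filter_congr fun i _ => ?_))
      by_cases hi : L i = U i
      · rw [hi]
      · have hUi : U i < t := (hU (hmax i hi)).trans_lt (not_le.1 hlt)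
        exact iff_of_false ((hLU i).trans_lt hUi).not_ge hUi.not_ge
  rw [coalTime, if_neg h, hidx.csSup_eq, hlevel.csSup_eq, coord_fin]

/-- change in C, case 1: if the minimal coordinates agree,
the time-to-coalescence is unchanged by an arrival. -/
theorem stmt6 {c : ℕ} (hc : 1 ≤ c) (L U : Fin c → ℝ)
    (hL : IsWorkload L) (hU : IsWorkload U) (hLU : ∀ k, L k ≤ U k)
    (h1 : coord L 0 = coord U 0) (S : ℝ) (hS : 0 < S) :
    coalTime (arr S L) (arr S U) = coalTime L U := by
  have hcount : ∀ t, countGe (arr S L) t + countGe U t = countGe (arr S U) t + countGe L t := by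
    intro t
    have hcL := countGe_arr hc S L t
    have hcU := countGe_arr hc S U t
    rw [h1] at hcL
    omega
  have harr : ∀ i, arr S L i ≤ arr S U i :=
    le_of_countGe_le (arr_monotone S L) (arr_monotone S U) fun t => by
      have := hcount t
      have := countGe_mono hLU t
      omega
  rw [coalTime_eq_sSup (arr_monotone S L) (arr_monotone S U) harr,
    coalTime_eq_sSup hL.1 hU.1 hLU]
  congr 1
  ext t
  have := hcount t
  simp only [Set.mem_ofPred_eq]
  omega
end

section
/- (Equation for the change in C, case 2.) Let L, U ∈ ℝ^c be workload vectors with L(k) ≤ U(k) for all k, and suppose the minimal coordinates disagree: L(1) < U(1). Then for any service duration S > 0, C(arr_S(L), arr_S(U)) = max{ C(L, U), U(1) + S }. -/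
open scoped Classical

/-- The number of coordinates of `V` that are at least `t`. -/
noncomputable def countGE {n : ℕ} (V : Fin n → ℝ) (t : ℝ) : ℕ :=
  (Finset.univ.filter fun i => t ≤ V i).card

theorem countGE_mono {n : ℕ} {V W : Fin n → ℝ} (h : ∀ i, V i ≤ W i) (t : ℝ) :
    countGE V t ≤ countGE W t :=
  Finset.card_le_card fun i hi => by
    simp only [Finset.mem_filter, Finset.mem_univ, true_and] at hi ⊢
    exact hi.trans (h i)

theorem countGE_comp_perm {n : ℕ} (V : Fin n → ℝ) (σ : Equiv.Perm (Fin n)) (t : ℝ) :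
    countGE (V ∘ σ) t = countGE V t :=
  Finset.card_equiv σ fun i => by simp

theorem countGE_lt_of_last_lt {n : ℕ} {V W : Fin n → ℝ} (hV : Monotone V) {k : Fin n}
    (hk : V k < W k) (h : ∀ i, k < i → V i = W i) :
    countGE V (W k) < countGE W (W k) := by
  apply Finset.card_lt_card
  rw [Finset.ssubset_iff_of_subset]
  · exact ⟨k, by simp, by simpa using hk⟩
  · intro i hi
    simp only [Finset.mem_filter, Finset.mem_univ, true_and] at hi ⊢
    have hki : k < i := by
      by_contra! hik
      linarith [hV hik]
    rwa [← h i hki]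

theorem countGE_le_of_gt_last {n : ℕ} {V W : Fin n → ℝ} (hW : Monotone W) {k : Fin n}
    (h : ∀ i, k < i → V i = W i) {t : ℝ} (ht : W k < t) :
    countGE W t ≤ countGE V t := by
  apply Finset.card_le_card
  intro i hi
  simp only [Finset.mem_filter, Finset.mem_univ, true_and] at hi ⊢
  have hki : k < i := by
    by_contra! hik
    linarith [hW hik]
  rwa [h i hki]

theorem exists_coalTime_eq {n : ℕ} {L U : Fin n → ℝ} (h : L ≠ U) :
    ∃ k, coalTime L U = U k ∧ L k ≠ U k ∧ ∀ i, k < i → L i = U i := by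
  obtain ⟨j, hj⟩ := Function.ne_iff.mp h
  let s : Set ℕ := {k : ℕ | k < n ∧ coord L k ≠ coord U k}
  have hbdd : BddAbove s := ⟨n, fun k hk => hk.1.le⟩
  obtain ⟨hlt, hne⟩ : sSup s ∈ s :=
    Nat.sSup_mem ⟨j, j.2, by simpa [coord] using hj⟩ hbdd
  refine ⟨⟨sSup s, hlt⟩, ?_, by simpa [coord, hlt] using hne, fun i hi => ?_⟩
  · rw [coalTime, if_neg h]
    change coord U (sSup s) = _
    rw [coord, dif_pos hlt]
  · by_contra hi'
    have hmem : (i : ℕ) ∈ s := ⟨i.2, by simpa [coord] using hi'⟩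
    exact absurd (le_csSup hbdd hmem) (not_le.mpr hi)

/-- The time-to-coalescence is the largest level at which the counts of `L` and `U` differ. -/
theorem countGE_coalTime {n : ℕ} {L U : Fin n → ℝ} (hL : Monotone L) (hU : Monotone U)
    (hle : ∀ t, countGE L t ≤ countGE U t) (h : L ≠ U) :
    countGE L (coalTime L U) < countGE U (coalTime L U) ∧
      ∀ t, coalTime L U < t → countGE U t ≤ countGE L t := by
  obtain ⟨k, hk, hne, hgt⟩ := exists_coalTime_eq h
  rw [hk]
  refine ⟨?_, fun t ht => countGE_le_of_gt_last hU hgt ht⟩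
  rcases hne.lt_or_gt with hlt | hlt
  · exact countGE_lt_of_last_lt hL hlt hgt
  · exact absurd (hle (L k))
      (not_le.mpr (countGE_lt_of_last_lt hU hlt fun i hi => (hgt i hi).symm))

theorem coalTime_eq_of_countGE {n : ℕ} {L U : Fin n → ℝ} (hL : Monotone L) (hU : Monotone U)
    (hle : ∀ t, countGE L t ≤ countGE U t) {x : ℝ} (hx : countGE L x < countGE U x)
    (hgt : ∀ t, x < t → countGE U t ≤ countGE L t) : coalTime L U = x := by
  have hne : L ≠ U := by
    rintro rfl
    exact lt_irrefl _ hx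
  obtain ⟨h, h'⟩ := countGE_coalTime hL hU hle hne
  rcases lt_trichotomy (coalTime L U) x with hlt | heq | hlt
  · exact absurd (h' x hlt) (not_le.mpr hx)
  · exact heq
  · exact absurd (hgt _ hlt) (not_le.mpr h)

theorem countGE_arr {n : ℕ} (S : ℝ) (V : Fin n → ℝ) (t : ℝ) :
    countGE (arr S V) t = countGE (bump S V) t :=
  countGE_comp_perm _ _ t

theorem bump_mono {n : ℕ} (S : ℝ) {V W : Fin n → ℝ} (h : ∀ i, V i ≤ W i) (i : Fin n) :
    bump S V i ≤ bump S W i := by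
  unfold bump
  split_ifs <;> linarith [h i]

/-- The arrival does not affect the counts at levels above `V(1) + S`. -/
theorem countGE_bump_of_lt {n : ℕ} {S : ℝ} (hS : 0 < S) (V : Fin n → ℝ) {t : ℝ}
    (ht : coord V 0 + S < t) : countGE (bump S V) t = countGE V t := by
  unfold countGE
  congr 1
  ext i
  simp only [Finset.mem_filter, Finset.mem_univ, true_and]
  unfold bump
  split_ifs with hi
  · have h0 : coord V 0 = V i := by
      rw [coord, dif_pos (hi ▸ i.2)]
      exact congrArg V (Fin.ext hi.symm)
    constructor <;> intro <;> linarith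
  · rfl

theorem countGE_bump_lt {n : ℕ} (hn : 0 < n) (S : ℝ) {L U : Fin n → ℝ}
    (hLU : ∀ i, L i ≤ U i) (h : coord L 0 < coord U 0) :
    countGE (bump S L) (coord U 0 + S) < countGE (bump S U) (coord U 0 + S) := by
  simp only [coord, dif_pos hn] at h ⊢
  apply Finset.card_lt_card
  rw [Finset.ssubset_iff_of_subset]
  · refine ⟨⟨0, hn⟩, ?_, ?_⟩ <;> simp only [Finset.mem_filter, Finset.mem_univ, true_and]
    · simp [bump]
    · simpa [bump] using h
  · intro i hi
    simp only [Finset.mem_filter, Finset.mem_univ, true_and] at hi ⊢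
    exact hi.trans (bump_mono S hLU i)

/-- change in C, case 2: if the minimal coordinates disagree, then
`C(arr S L, arr S U) = max (C(L,U)) (U(1) + S)`. -/
theorem stmt7 {c : ℕ} (hc : 1 ≤ c) (L U : Fin c → ℝ)
    (hL : IsWorkload L) (hU : IsWorkload U) (hLU : ∀ k, L k ≤ U k)
    (h1 : coord L 0 < coord U 0) (S : ℝ) (hS : 0 < S) :
    coalTime (arr S L) (arr S U) = max (coalTime L U) (coord U 0 + S) := by
  have hne : L ≠ U := by
    rintro rfl
    exact lt_irrefl _ h1
  obtain ⟨hC, hC'⟩ := countGE_coalTime hL.1 hU.1 (countGE_mono hLU) hne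
  apply coalTime_eq_of_countGE (arr_monotone S L) (arr_monotone S U)
  · intro t
    rw [countGE_arr, countGE_arr]
    exact countGE_mono (bump_mono S hLU) t
  · rw [countGE_arr, countGE_arr]
    rcases le_or_gt (coalTime L U) (coord U 0 + S) with h | h
    · rw [max_eq_right h]
      exact countGE_bump_lt hc S hLU h1
    · rwa [max_eq_left h.le, countGE_bump_of_lt hS U h,
        countGE_bump_of_lt hS L (by linarith)]
  · intro t ht
    obtain ⟨ht₁, ht₂⟩ := max_lt_iff.mp ht
    rw [countGE_arr, countGE_arr, countGE_bump_of_lt hS U ht₂,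
      countGE_bump_of_lt hS L (by linarith)]
    exact hC' t ht₁
end

section
/- (Coordinatewise monotonicity of the Kiefer–Wolfowitz update in the workload and service duration.) Let W, W' ∈ ℝ^c be workload vectors with W'(k) ≤ W(k) for all k, and let 0 ≤ S' ≤ S and t ≥ 0. Then step_{S',t}(W')(k) ≤ step_{S,t}(W)(k) for all k = 1,…,c. -/
open scoped Classical

/-- The increasing rearrangement of a tuple is monotone in the tuple. -/
theorem comp_sort_mono {n : ℕ} {α : Type*} [LinearOrder α] {f g : Fin n → α} (h : f ≤ g) :
    f ∘ Tuple.sort f ≤ g ∘ Tuple.sort g := by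
  intro j
  have card_comp_perm (u : Fin n → α) (σ : Equiv.Perm (Fin n)) (a : α) :
      (Finset.univ.filter fun i => (u ∘ σ) i ≤ a).card =
        (Finset.univ.filter fun i => u i ≤ a).card :=
    Finset.card_equiv σ (by simp)
  rw [← Tuple.lt_card_le_iff_apply_le_of_monotone (Tuple.monotone_sort f), card_comp_perm]
  have hj := (Tuple.lt_card_le_iff_apply_le_of_monotone (j := j)
    (Tuple.monotone_sort g)).2 le_rfl
  rw [card_comp_perm] at hj
  exact hj.trans_le (Finset.card_le_card fun i hi => by
    simp only [Finset.mem_filter, Finset.mem_univ, true_and] at hi ⊢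
    exact (h i).trans hi)

theorem bump_mono_s13 {n : ℕ} {S S' : ℝ} {V V' : Fin n → ℝ} (hS : S' ≤ S) (hV : V' ≤ V) :
    bump S' V' ≤ bump S V := by
  intro i
  unfold bump
  split_ifs
  · exact add_le_add (hV i) hS
  · exact hV i

/-- coordinatewise monotonicity of the Kiefer-Wolfowitz update in the
workload vector and the service duration. -/
theorem stmt13 {c : ℕ} (hc : 1 ≤ c)
    (W W' : Fin c → ℝ) (hW : IsWorkload W) (hW' : IsWorkload W')
    (hle : ∀ k, W' k ≤ W k)
    (S S' t : ℝ) (hS' : 0 ≤ S') (hSS : S' ≤ S) (ht : 0 ≤ t) :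
    ∀ k, step S' t W' k ≤ step S t W k := by
  intro k
  exact max_le_max_right 0 (sub_le_sub_right (comp_sort_mono (bump_mono_s13 hSS hle) k) t)
end
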